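/- Let n ≥ 0, let a = (a_0,…,a_n) be positive integers and m = (m_0,…,m_n) integers with 0 ≤ m_j ≤ a_j−1. Let L_m = {z ∈ ℂ^{n+1} : z_0^{a_0}+⋯+z_n^{a_n} = 1 and e^{2πi m_j/a_j}·conj(z_j) = z_j for all j}, and let L̃_m = {z ∈ L_m : z_j^{a_j} is a nonnegative real number for all j}. Then L̃_m is a deformation retract of L_m: there exists a continuous map G : L_m × [0,1] → L_m such that G(z,0) = z for all z ∈ L_m, G(z,1) ∈ L̃_m for all z ∈ L_m, and G(z,t) = z for all z ∈ L̃_m and all t ∈ [0,1]. -/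

import Mathlib

noncomputable section

/-- The reflection `R_m^a : ℂ → ℂ`, `z ↦ e^{2πim/a} ⬝ conj z`. -/
def refl1 (a m : ℕ) (z : ℂ) : ℂ :=
  Complex.exp (2 * (Real.pi : ℂ) * Complex.I * (m : ℂ) / (a : ℂ)) * (starRingEnd ℂ) z

/-- The real Lagrangian `L_𝐦` inside the Milnor fiber `V(𝐚) ⊆ ℂ^{n+1}`. -/
def LSet (n : ℕ) (a m : Fin (n + 1) → ℕ) : Set (Fin (n + 1) → ℂ) :=
  {z | ∑ j, z j ^ a j = 1 ∧ ∀ j, refl1 (a j) (m j) (z j) = z j}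

/-- The subset `L̃_𝐦 ⊆ L_𝐦` of points all of whose coordinates satisfy `z_j^{a_j} ≥ 0`. -/
def LTilde (n : ℕ) (a m : Fin (n + 1) → ℕ) : Set (Fin (n + 1) → ℂ) :=
  {z | z ∈ LSet n a m ∧ ∀ j, ∃ r : ℝ, 0 ≤ r ∧ z j ^ a j = (r : ℂ)}

/-- The power `z ^ a` of a point fixed by `refl1 a m` is real. -/
theorem pow_eq_re_of_refl1_eq {a m : ℕ} (ha : 0 < a) {z : ℂ} (h : refl1 a m z = z) :
    z ^ a = ((z ^ a).re : ℂ) := by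
  have hexp : Complex.exp (2 * (Real.pi : ℂ) * Complex.I * (m : ℂ) / (a : ℂ)) ^ a = 1 := by
    rw [← Complex.exp_nat_mul, Complex.exp_eq_one_iff]
    refine ⟨m, ?_⟩
    have : (a : ℂ) ≠ 0 := by exact_mod_cast ha.ne'
    push_cast
    field_simp
  have hconj : (starRingEnd ℂ) (z ^ a) = z ^ a := by
    have := congrArg (· ^ a) h
    simpa only [refl1, mul_pow, hexp, one_mul, map_pow] using this
  exact (Complex.conj_eq_iff_re.mp hconj).symm

/-- Fixed points of `refl1 a m` are stable under real scaling. -/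
theorem refl1_ofReal_mul {a m : ℕ} {z : ℂ} (r : ℝ) (h : refl1 a m z = z) :
    refl1 a m (r * z) = r * z := by
  unfold refl1 at *
  rw [map_mul, Complex.conj_ofReal, mul_left_comm, h]

/-- Multiply `z ^ a` by `c` where its real part is nonnegative and by `d` where it is negative,
moving `z` along its ray. -/
def scaleSigned (a : ℕ) (c d : ℝ) (z : ℂ) : ℂ :=
  if 0 ≤ (z ^ a).re then ((c ^ (a : ℝ)⁻¹ : ℝ) : ℂ) * z else ((d ^ (a : ℝ)⁻¹ : ℝ) : ℂ) * z

theorem refl1_scaleSigned {a m : ℕ} {z : ℂ} (c d : ℝ) (h : refl1 a m z = z) :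
    refl1 a m (scaleSigned a c d z) = scaleSigned a c d z := by
  unfold scaleSigned
  split_ifs <;> exact refl1_ofReal_mul _ h

theorem scaleSigned_pow {a m : ℕ} (ha : 0 < a) {c d : ℝ} (hc : 0 ≤ c) (hd : 0 ≤ d) {z : ℂ}
    (h : refl1 a m z = z) :
    scaleSigned a c d z ^ a =
      ((c * max (z ^ a).re 0 - d * max (-(z ^ a).re) 0 : ℝ) : ℂ) := by
  have hz := pow_eq_re_of_refl1_eq ha h
  unfold scaleSigned
  split_ifs with hs
  · rw [mul_pow, ← Complex.ofReal_pow, Real.rpow_inv_natCast_pow hc ha.ne', max_eq_left hs,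
      max_eq_right (by linarith), mul_zero, sub_zero, Complex.ofReal_mul, ← hz]
  · rw [mul_pow, ← Complex.ofReal_pow, Real.rpow_inv_natCast_pow hd ha.ne',
      max_eq_right (by linarith), max_eq_left (by linarith), mul_zero, zero_sub, mul_neg, neg_neg,
      Complex.ofReal_mul, ← hz]

theorem scaleSigned_eq_self {a : ℕ} {d : ℝ} {z : ℂ} (hz : 0 ≤ (z ^ a).re) :
    scaleSigned a 1 d z = z := by
  simp [scaleSigned, hz]

theorem scaleSigned_one_one (a : ℕ) (z : ℂ) : scaleSigned a 1 1 z = z := by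
  simp [scaleSigned]

theorem continuous_scaleSigned {X : Type*} [TopologicalSpace X] {a m : ℕ} (ha : 0 < a)
    {c d : X → ℝ} {z : X → ℂ} (hc : Continuous c) (hd : Continuous d) (hz : Continuous z)
    (h : ∀ x, refl1 a m (z x) = z x) :
    Continuous fun x => scaleSigned a (c x) (d x) (z x) := by
  have hexp : (0 : ℝ) ≤ (a : ℝ)⁻¹ := by positivity
  unfold scaleSigned
  refine Continuous.if_le ?_ ?_ continuous_const (Complex.continuous_re.comp (hz.pow a)) ?_
  · exact (Complex.continuous_ofReal.comp (hc.rpow_const fun _ => Or.inr hexp)).mul hz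
  · exact (Complex.continuous_ofReal.comp (hd.rpow_const fun _ => Or.inr hexp)).mul hz
  · intro x hx
    have hpow := pow_eq_re_of_refl1_eq ha (h x)
    rw [← hx, Complex.ofReal_zero] at hpow
    simp [eq_zero_of_pow_eq_zero hpow]

/-- The total absolute value of the negative real parts among the `z j ^ a j`. -/
def negMass {ι : Type*} [Fintype ι] (a : ι → ℕ) (z : ι → ℂ) : ℝ :=
  ∑ j, max (-(z j ^ a j).re) 0

theorem negMass_nonneg {ι : Type*} [Fintype ι] (a : ι → ℕ) (z : ι → ℂ) : 0 ≤ negMass a z :=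
  Finset.sum_nonneg fun _ _ => le_max_right _ _

theorem continuous_negMass {ι : Type*} [Fintype ι] (a : ι → ℕ) : Continuous (negMass a) := by
  unfold negMass
  fun_prop

theorem sum_max_re_eq_one_add_negMass {n : ℕ} {a m : Fin (n + 1) → ℕ} {z : Fin (n + 1) → ℂ}
    (hz : z ∈ LSet n a m) : ∑ j, max (z j ^ a j).re 0 = 1 + negMass a z := by
  have hre : ∑ j, (z j ^ a j).re = 1 := by
    rw [← Complex.re_sum, hz.1, Complex.one_re]
  rw [← hre, negMass, ← Finset.sum_add_distrib]
  refine Finset.sum_congr rfl fun j _ => ?_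
  rcases le_total 0 (z j ^ a j).re with h | h
  · rw [max_eq_left h, max_eq_right (by linarith), add_zero]
  · rw [max_eq_right h, max_eq_left (by linarith), add_neg_cancel]

theorem negMass_eq_zero {n : ℕ} {a m : Fin (n + 1) → ℕ} {z : Fin (n + 1) → ℂ}
    (hz : z ∈ LTilde n a m) : negMass a z = 0 := by
  refine Finset.sum_eq_zero fun j _ => ?_
  obtain ⟨r, hr, hrz⟩ := hz.2 j
  simpa [hrz] using hr

/-- The factor by which the nonnegative parts are scaled when the negative ones are scaled
by `1 - t`. -/
def posFactor {ι : Type*} [Fintype ι] (a : ι → ℕ) (z : ι → ℂ) (t : ℝ) : ℝ :=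
  (1 + (1 - t) * negMass a z) / (1 + negMass a z)

theorem posFactor_nonneg {ι : Type*} [Fintype ι] (a : ι → ℕ) (z : ι → ℂ) {t : ℝ} (ht : t ≤ 1) :
    0 ≤ posFactor a z t := by
  have hN := negMass_nonneg a z
  have ht' := sub_nonneg.mpr ht
  unfold posFactor
  positivity

/-- The retracting flow at time `t`. -/
def retractFlow {ι : Type*} [Fintype ι] (a : ι → ℕ) (z : ι → ℂ) (t : ℝ) : ι → ℂ :=
  fun j => scaleSigned (a j) (posFactor a z t) (1 - t) (z j)

theorem retractFlow_mem_LSet {n : ℕ} {a m : Fin (n + 1) → ℕ} (ha : ∀ j, 0 < a j)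
    {z : Fin (n + 1) → ℂ} (hz : z ∈ LSet n a m) {t : ℝ} (ht : t ≤ 1) :
    retractFlow a z t ∈ LSet n a m := by
  refine ⟨?_, fun j => refl1_scaleSigned _ _ (hz.2 j)⟩
  have hN := negMass_nonneg a z
  have hsum : ∑ j, retractFlow a z t j ^ a j =
      ((posFactor a z t * (1 + negMass a z) - (1 - t) * negMass a z : ℝ) : ℂ) := by
    rw [← sum_max_re_eq_one_add_negMass hz, negMass, Finset.mul_sum, Finset.mul_sum,
      ← Finset.sum_sub_distrib, Complex.ofReal_sum]
    exact Finset.sum_congr rfl fun j _ =>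
      scaleSigned_pow (ha j) (posFactor_nonneg a z ht) (sub_nonneg.mpr ht) (hz.2 j)
  rw [hsum, posFactor, div_mul_cancel₀ _ (by positivity), add_sub_cancel_right,
    Complex.ofReal_one]

theorem retractFlow_zero {ι : Type*} [Fintype ι] (a : ι → ℕ) (z : ι → ℂ) :
    retractFlow a z 0 = z := by
  have hN := negMass_nonneg a z
  have hpos : posFactor a z 0 = 1 := by
    rw [posFactor, sub_zero, one_mul, div_self (by positivity)]
  funext j
  rw [retractFlow, hpos, sub_zero, scaleSigned_one_one]

theorem retractFlow_one_mem_LTilde {n : ℕ} {a m : Fin (n + 1) → ℕ} (ha : ∀ j, 0 < a j)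
    {z : Fin (n + 1) → ℂ} (hz : z ∈ LSet n a m) : retractFlow a z 1 ∈ LTilde n a m := by
  refine ⟨retractFlow_mem_LSet ha hz le_rfl, fun j => ⟨_, ?_,
    scaleSigned_pow (ha j) (posFactor_nonneg a z le_rfl) (sub_nonneg.mpr le_rfl) (hz.2 j)⟩⟩
  rw [sub_self, zero_mul, sub_zero]
  exact mul_nonneg (posFactor_nonneg a z le_rfl) (le_max_right _ _)

theorem retractFlow_eq_self {n : ℕ} {a m : Fin (n + 1) → ℕ} {z : Fin (n + 1) → ℂ}
    (hz : z ∈ LTilde n a m) (t : ℝ) : retractFlow a z t = z := by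
  have hpos : posFactor a z t = 1 := by simp [posFactor, negMass_eq_zero hz]
  funext j
  obtain ⟨r, hr, hrz⟩ := hz.2 j
  rw [retractFlow, hpos, scaleSigned_eq_self (by simpa [hrz] using hr)]

theorem continuous_retractFlow {n : ℕ} {a m : Fin (n + 1) → ℕ} (ha : ∀ j, 0 < a j) :
    Continuous fun p : LSet n a m × Set.Icc (0 : ℝ) 1 =>
      retractFlow a (p.1 : Fin (n + 1) → ℂ) p.2 := by
  have hz : Continuous fun p : LSet n a m × Set.Icc (0 : ℝ) 1 => (p.1 : Fin (n + 1) → ℂ) :=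
    continuous_subtype_val.comp continuous_fst
  have ht : Continuous fun p : LSet n a m × Set.Icc (0 : ℝ) 1 => 1 - (p.2 : ℝ) :=
    continuous_const.sub (continuous_subtype_val.comp continuous_snd)
  have hN := (continuous_negMass a).comp hz
  have hpos : Continuous fun p : LSet n a m × Set.Icc (0 : ℝ) 1 =>
      posFactor a (p.1 : Fin (n + 1) → ℂ) p.2 := by
    refine (continuous_const.add (ht.mul hN)).div (continuous_const.add hN) fun p => ?_
    have := negMass_nonneg a (p.1 : Fin (n + 1) → ℂ)
    change 1 + negMass a (p.1 : Fin (n + 1) → ℂ) ≠ 0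
    positivity
  exact continuous_pi fun j =>
    continuous_scaleSigned (ha j) hpos ht ((continuous_apply j).comp hz) fun p => p.1.2.2 j

/-- **Lemma**: `L̃_𝐦` is a deformation retract of `L_𝐦`. -/
theorem deformation_retract_onto_nonneg_part (n : ℕ) (a m : Fin (n + 1) → ℕ)
    (ha : ∀ j, 0 < a j) (hm : ∀ j, m j < a j) :
    ∃ G : ↥(LSet n a m) × ↥(Set.Icc (0 : ℝ) 1) → ↥(LSet n a m),
      Continuous G ∧
      (∀ z, G (z, ⟨0, by norm_num⟩) = z) ∧
      (∀ z, ((G (z, ⟨1, by norm_num⟩) : Fin (n + 1) → ℂ)) ∈ LTilde n a m) ∧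
      (∀ (z : ↥(LSet n a m)) (t : ↥(Set.Icc (0 : ℝ) 1)),
        (z : Fin (n + 1) → ℂ) ∈ LTilde n a m → G (z, t) = z) := by
  exact ⟨fun p => ⟨retractFlow a p.1 p.2, retractFlow_mem_LSet ha p.1.2 p.2.2.2⟩,
    (continuous_retractFlow ha).subtype_mk _,
    fun z => Subtype.ext (retractFlow_zero a z),
    fun z => retractFlow_one_mem_LTilde ha z.2,
    fun z t hz => Subtype.ext (retractFlow_eq_self hz t)⟩
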